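/- Let N ≥ 1 be an integer, p ∈ (1,∞), s ∈ (0,1), Λ > 0, and let K : ℝ^N ∖ {0} → (0,∞) be measurable with K(-z) = K(z) and K(z) ≤ Λ |z|^{-(N+sp)} for all z ≠ 0. Let Ω ⊆ ℝ^N be open, 𝒦 ⊂ Ω compact, I ⊂ ℝ a bounded interval, U open with 𝒦 ⊂ U and closure(U) compact and contained in Ω, and let ρ > 0 satisfy B_ρ(x) ⊆ U for every x ∈ 𝒦. Let φ ∈ C²_x ∩ C¹_t(U × I) with φ, ∇_x φ, D²_x φ and ∂_t φ bounded on U × I, and with ∇_x φ(x,t) ≠ 0 for every (x,t) ∈ 𝒦 × I. Then for every (x,t) ∈ 𝒦 × I the principal value L_K^{B_ρ} φ(x,t) := lim_{δ→0+} ∫_{{y : δ < |x-y| < ρ}} J_p(φ(x,t)-φ(y,t)) K(x-y) dy exists, and the map (x,t) ↦ ∂_t φ(x,t) + L_K^{B_ρ} φ(x,t) is continuous on 𝒦 × I. -/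

import Mathlib

open MeasureTheory Set Metric Filter
open scoped ENNReal NNReal Topology Classical

noncomputable section

abbrev Euc (N : ℕ) := EuclideanSpace ℝ (Fin N)

/-- `J_p(t) = |t|^{p-2} t`. -/
def Jp (p t : ℝ) : ℝ := |t| ^ (p - 2) * t

/-- A symmetric kernel comparable to the fractional `p`-Laplace kernel. -/
def IsKernel (N : ℕ) (p s lam Lam : ℝ) (K : Euc N → ℝ) : Prop :=
  Measurable K ∧
  (∀ z : Euc N, z ≠ 0 → 0 < K z) ∧
  (∀ z : Euc N, z ≠ 0 → K (-z) = K z) ∧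
  (∀ z : Euc N, z ≠ 0 →
    lam * ‖z‖ ^ (-((N : ℝ) + s * p)) ≤ K z ∧ K z ≤ Lam * ‖z‖ ^ (-((N : ℝ) + s * p)))

/-- Local weak solution of `∂ₜ u + L_K u = 0` in `Ω × I`. -/
def IsLocalWeakSolution (N : ℕ) (p s : ℝ) (K : Euc N → ℝ)
    (Ω : Set (Euc N)) (I : Set ℝ) (u : Euc N → ℝ → ℝ) : Prop :=
  (∀ J : Set ℝ, IsCompact J → J ⊆ interior I →
    ∀ U : Set (Euc N), IsOpen U → IsCompact (closure U) → closure U ⊆ Ω →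
      (∫⁻ t in J, ∫⁻ x in U, ∫⁻ y in U,
          ENNReal.ofReal (|u x t - u y t| ^ p * ‖x - y‖ ^ (-((N : ℝ) + s * p)))) < ⊤ ∧
      (∫⁻ t in J, ∫⁻ x in U, ENNReal.ofReal (|u x t| ^ p)) < ⊤ ∧
      essSup (fun t => ∫⁻ x, ENNReal.ofReal (|u x t| ^ (p - 1) / (1 + ‖x‖ ^ ((N : ℝ) + s * p))))
        (volume.restrict J) < ⊤ ∧
      (∀ t₀ ∈ I, Tendsto (fun t => ∫ x in U, (u x t - u x t₀) ^ 2)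
          (nhdsWithin t₀ I) (nhds 0))) ∧
  (∀ φ : Euc N × ℝ → ℝ, ContDiff ℝ (⊤ : ℕ∞) φ → HasCompactSupport φ →
    tsupport φ ⊆ Ω ×ˢ interior I →
    -(∫ t in I, ∫ x in Ω, u x t * deriv (fun τ => φ (x, τ)) t) +
      (1 / 2) * ∫ t in I, ∫ x, ∫ y,
        Jp p (u x t - u y t) * (φ (x, t) - φ (y, t)) * K (x - y) = 0)

/-- Essential supremum of `|u|` over a space-time set. -/
def supAbs (N : ℕ) (u : Euc N → ℝ → ℝ) (Q : Set (Euc N × ℝ)) : ℝ≥0∞ :=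
  essSup (fun q : Euc N × ℝ => ENNReal.ofReal |u q.1 q.2|) (volume.restrict Q)

/-- The nonlocal tail `Tail(w; x₀, r)`. -/
def tailFn (N : ℕ) (p s : ℝ) (w : Euc N → ℝ) (x₀ : Euc N) (r : ℝ) : ℝ :=
  (r ^ (s * p) *
    ∫ x in (ball x₀ r)ᶜ, |w x| ^ (p - 1) * ‖x - x₀‖ ^ (-((N : ℝ) + s * p))) ^ (1 / (p - 1))

/-- The parabolic tail `Tail_∞(u; x₀, r, J)`. -/
def tailSup (N : ℕ) (p s : ℝ) (u : Euc N → ℝ → ℝ) (x₀ : Euc N) (r : ℝ) (J : Set ℝ) : ℝ≥0∞ :=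
  essSup (fun t => ENNReal.ofReal (tailFn N p s (fun x => u x t) x₀ r)) (volume.restrict J)

/-- `M_R = ‖u‖_{L^∞(Q_{2R,2R^{sp}}(x₀,t₀))} + Tail_∞(u; x₀, R, (t₀-2R^{sp},t₀]) + 1`. -/
def MR (N : ℕ) (p s : ℝ) (u : Euc N → ℝ → ℝ) (x₀ : Euc N) (R t₀ : ℝ) : ℝ≥0∞ :=
  supAbs N u (ball x₀ (2 * R) ×ˢ Ioc (t₀ - 2 * R ^ (s * p)) t₀)
    + tailSup N p s u x₀ R (Ioc (t₀ - 2 * R ^ (s * p)) t₀) + 1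

/-- `φ ∈ C²ₓ ∩ C¹ₜ(U × I)` with derivative data `Dφ, D2φ, φt`. -/
def C2xC1t (N : ℕ) (U : Set (Euc N)) (I : Set ℝ) (φ : Euc N → ℝ → ℝ)
    (Dφ : Euc N → ℝ → (Euc N →L[ℝ] ℝ)) (D2φ : Euc N → ℝ → (Euc N →L[ℝ] Euc N →L[ℝ] ℝ))
    (φt : Euc N → ℝ → ℝ) : Prop :=
  ContinuousOn (fun q : Euc N × ℝ => φ q.1 q.2) (U ×ˢ I) ∧
  (∀ x ∈ U, ∀ t ∈ I, HasFDerivAt (fun y => φ y t) (Dφ x t) x) ∧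
  ContinuousOn (fun q : Euc N × ℝ => Dφ q.1 q.2) (U ×ˢ I) ∧
  (∀ x ∈ U, ∀ t ∈ I, HasFDerivAt (fun y => Dφ y t) (D2φ x t) x) ∧
  ContinuousOn (fun q : Euc N × ℝ => D2φ q.1 q.2) (U ×ˢ I) ∧
  (∀ x ∈ U, ∀ t ∈ I, HasDerivWithinAt (fun τ => φ x τ) (φt x t) I t) ∧
  ContinuousOn (fun q : Euc N × ℝ => φt q.1 q.2) (U ×ˢ I)

/-- The truncated integral over the annulus `δ < |x - y| < ρ`. -/
def pvIntegral (N : ℕ) (p ρ : ℝ) (K : Euc N → ℝ) (w : Euc N → ℝ) (x : Euc N) (δ : ℝ) : ℝ :=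
  ∫ y in {y : Euc N | δ < dist y x ∧ dist y x < ρ}, Jp p (w x - w y) * K (x - y)

/-- Existence of the principal value `L_K^{B_ρ} w (x) = l`. -/
def HasPV (N : ℕ) (p ρ : ℝ) (K : Euc N → ℝ) (w : Euc N → ℝ) (x : Euc N) (l : ℝ) : Prop :=
  Tendsto (fun δ => pvIntegral N p ρ K w x δ) (nhdsWithin 0 (Ioi 0)) (nhds l)

/-- Weak supersolution of `∂ₜ w + L_K^{B_ρ} w = f` in `U × I`. -/
def IsTruncSuper (N : ℕ) (p ρ : ℝ) (K : Euc N → ℝ) (U : Set (Euc N)) (I : Set ℝ)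
    (f w : Euc N → ℝ → ℝ) : Prop :=
  ∀ φ : Euc N × ℝ → ℝ, ContDiff ℝ (⊤ : ℕ∞) φ → HasCompactSupport φ →
    tsupport φ ⊆ U ×ˢ interior I → (∀ q, 0 ≤ φ q) →
    ∫ t in I, ∫ x in U, f x t * φ (x, t) ≤
      -(∫ t in I, ∫ x in U, w x t * deriv (fun τ => φ (x, τ)) t) +
        (1 / 2) * ∫ t in I, ∫ q in {q : Euc N × Euc N | dist q.1 q.2 < ρ},
          Jp p (w q.1 t - w q.2 t) * (φ (q.1, t) - φ (q.2, t)) * K (q.1 - q.2)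

/-- Weak subsolution of `∂ₜ w + L_K^{B_ρ} w = f` in `U × I`. -/
def IsTruncSub (N : ℕ) (p ρ : ℝ) (K : Euc N → ℝ) (U : Set (Euc N)) (I : Set ℝ)
    (f w : Euc N → ℝ → ℝ) : Prop :=
  ∀ φ : Euc N × ℝ → ℝ, ContDiff ℝ (⊤ : ℕ∞) φ → HasCompactSupport φ →
    tsupport φ ⊆ U ×ˢ interior I → (∀ q, 0 ≤ φ q) →
    -(∫ t in I, ∫ x in U, w x t * deriv (fun τ => φ (x, τ)) t) +
        (1 / 2) * ∫ t in I, ∫ q in {q : Euc N × Euc N | dist q.1 q.2 < ρ},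
          Jp p (w q.1 t - w q.2 t) * (φ (q.1, t) - φ (q.2, t)) * K (q.1 - q.2) ≤
      ∫ t in I, ∫ x in U, f x t * φ (x, t)

lemma Jp_neg (p t : ℝ) : Jp p (-t) = - Jp p t := by
  simp [Jp]

lemma Jp_of_nonneg {p t : ℝ} (hp : 1 < p) (ht : 0 ≤ t) : Jp p t = t ^ (p - 1) := by
  rcases ht.eq_or_lt with rfl | h
  · simp [Jp, Real.zero_rpow (by linarith : p - 1 ≠ 0)]
  · rw [Jp, abs_of_pos h]
    nth_rewrite 2 [← Real.rpow_one t]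
    rw [← Real.rpow_add h]; ring_nf

lemma abs_Jp {p : ℝ} (hp : 1 < p) (t : ℝ) : |Jp p t| = |t| ^ (p - 1) := by
  rcases le_total 0 t with h | h
  · rw [Jp_of_nonneg hp h, abs_of_nonneg h, abs_of_nonneg (by positivity)]
  · have := Jp_of_nonneg hp (neg_nonneg.2 h)
    rw [Jp_neg] at this
    rw [← abs_neg, this, abs_of_nonpos h, abs_of_nonneg]
    exact Real.rpow_nonneg (by linarith) _

lemma Jp_continuous {p : ℝ} (hp : 1 < p) : Continuous (Jp p) := by
  rw [continuous_iff_continuousAt]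
  intro t
  by_cases h : t = 0
  · subst h
    have h0 : Jp p 0 = 0 := by simp [Jp]
    rw [ContinuousAt, h0, tendsto_zero_iff_abs_tendsto_zero]
    have : (abs ∘ Jp p) = fun t => |t| ^ (p - 1) := by
      funext t; exact abs_Jp hp t
    rw [this]
    have hc : Continuous fun t : ℝ => |t| ^ (p - 1) :=
      continuous_abs.rpow_const (fun _ => Or.inr (by linarith))
    have := hc.tendsto 0
    simpa [Real.zero_rpow (by linarith : p - 1 ≠ 0)] using this
  · unfold Jp
    exact (continuous_abs.continuousAt.rpow_const (Or.inl (by simpa using h))).mul continuousAt_id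

lemma Jp_low_pos {p u v : ℝ} (hp : 1 < p) (hp2 : p ≤ 2) (hv : 0 < v) :
    |Jp p u - Jp p v| ≤ 2 * |u - v| * v ^ (p - 2) := by
  have hvp : v ^ (p - 1) = v * v ^ (p - 2) := by
    nth_rewrite 2 [← Real.rpow_one v]
    rw [← Real.rpow_add hv]; ring_nf
  have hw : 0 < v ^ (p - 2) := by positivity
  -- u = v * r
  obtain ⟨r, rfl⟩ : ∃ r, u = v * r := ⟨u / v, by field_simp⟩
  have hJ : ∀ r : ℝ, 0 ≤ r → Jp p (v * r) = v * v ^ (p - 2) * r ^ (p - 1) := by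
    intro r hr
    rw [Jp_of_nonneg hp (by positivity), Real.mul_rpow hv.le hr, hvp]
  rw [Jp_of_nonneg hp hv.le, hvp]
  have key : ∀ r : ℝ, 0 ≤ r → |r ^ (p - 1) - 1| ≤ |r - 1| := by
    intro r hr
    rcases le_total 1 r with h | h
    · have h1 : 1 ≤ r ^ (p - 1) := Real.one_le_rpow h (by linarith)
      have h2 : r ^ (p - 1) ≤ r ^ (1 : ℝ) := Real.rpow_le_rpow_of_exponent_le h (by linarith)
      rw [Real.rpow_one] at h2
      rw [abs_of_nonneg (by linarith), abs_of_nonneg (by linarith)]; linarith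
    · have h1 : r ^ (p - 1) ≤ 1 := Real.rpow_le_one hr h (by linarith)
      have h2 : r ≤ r ^ (p - 1) := by
        rcases hr.eq_or_lt with rfl | h0
        · positivity
        · have := Real.rpow_le_rpow_of_exponent_ge h0 h (by linarith : p - 1 ≤ 1)
          rwa [Real.rpow_one] at this
      rw [abs_of_nonpos (by linarith), abs_of_nonpos (by linarith)]; linarith
  have e2 : |v * r - v| = v * |r - 1| := by
    rw [← mul_sub_one, abs_mul, abs_of_pos hv]
  rw [e2]
  rcases le_total 0 r with h | h
  · rw [hJ r h, ← mul_sub_one, abs_mul, abs_of_pos (by positivity)]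
    have := key r h
    have h3 : v * v ^ (p - 2) * |r ^ (p - 1) - 1| ≤ v * v ^ (p - 2) * |r - 1| := by gcongr
    have : 0 ≤ v * v ^ (p - 2) * |r - 1| := by positivity
    nlinarith
  · have e := hJ (-r) (by linarith)
    rw [mul_neg, Jp_neg] at e
    have hk := key (-r) (by linarith)
    have hn : 0 ≤ (-r) ^ (p - 1) := Real.rpow_nonneg (by linarith) _
    have h4 : (-r) ^ (p - 1) + 1 ≤ 2 * (1 - r) := by
      have h6 := (abs_le.1 hk).2
      rcases le_total (-r) 1 with h5 | h5
      · have := Real.rpow_le_one (by linarith : 0 ≤ -r) h5 (by linarith : 0 ≤ p - 1)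
        linarith
      · rw [abs_of_nonneg (by linarith : 0 ≤ -r - 1)] at h6
        linarith
    have e3 : Jp p (v * r) - v * v ^ (p - 2) = -(v * v ^ (p - 2) * ((-r) ^ (p - 1) + 1)) := by
      linarith
    rw [e3, abs_neg, abs_of_nonneg (by positivity), abs_of_nonpos (by linarith)]
    have : v * v ^ (p - 2) * ((-r) ^ (p - 1) + 1) ≤ v * v ^ (p - 2) * (2 * (1 - r)) := by gcongr
    nlinarith

lemma Jp_low {p u v : ℝ} (hp : 1 < p) (hp2 : p ≤ 2) (hv : v ≠ 0) :
    |Jp p u - Jp p v| ≤ 2 * |u - v| * |v| ^ (p - 2) := by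
  rcases lt_or_gt_of_ne hv with h | h
  · have := Jp_low_pos (u := -u) hp hp2 (neg_pos.2 h)
    rw [Jp_neg, Jp_neg] at this
    rw [abs_of_neg h]
    convert this using 1
    · rw [← abs_neg]; ring_nf
    · rw [← abs_neg (u - v)]; ring_nf
  · rw [abs_of_pos h]; exact Jp_low_pos hp hp2 h

lemma Jp_high_ord {p M u v : ℝ} (hp2 : 2 ≤ p) (hv : 0 ≤ v) (huv : v ≤ u) (hu : u ≤ M) :
    |Jp p u - Jp p v| ≤ (p - 1) * M ^ (p - 2) * (u - v) := by
  have hp : 1 < p := by linarith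
  have hu0 : 0 ≤ u := hv.trans huv
  rw [Jp_of_nonneg hp hv, Jp_of_nonneg hp hu0]
  have h1 : v ^ (p - 1) ≤ u ^ (p - 1) := Real.rpow_le_rpow hv huv (by linarith)
  rw [abs_of_nonneg (by linarith)]
  rcases hu0.eq_or_lt with h0 | h0
  · have : v = 0 := by linarith
    subst this; subst h0; simp
  have hb := one_add_mul_self_le_rpow_one_add (s := v / u - 1)
    (by have : 0 ≤ v / u := by positivity
        linarith) (p := p - 1) (by linarith)
  rw [show 1 + (v / u - 1) = v / u by ring, Real.div_rpow hv h0.le] at hb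
  have hup : u ^ (p - 1) = u * u ^ (p - 2) := by
    nth_rewrite 2 [← Real.rpow_one u]
    rw [← Real.rpow_add h0]; ring_nf
  have hpos : 0 < u ^ (p - 1) := by positivity
  rw [le_div_iff₀ hpos] at hb
  have e : (1 + (p - 1) * (v / u - 1)) * u ^ (p - 1)
      = u ^ (p - 1) - (p - 1) * u ^ (p - 2) * (u - v) := by
    rw [hup]; field_simp; ring
  rw [e] at hb
  have h2 : u ^ (p - 2) ≤ M ^ (p - 2) := Real.rpow_le_rpow hu0 hu (by linarith)
  have h3 : (p - 1) * u ^ (p - 2) * (u - v) ≤ (p - 1) * M ^ (p - 2) * (u - v) := by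
    have : 0 ≤ p - 1 := by linarith
    have : 0 ≤ u - v := by linarith
    gcongr
  linarith

lemma Jp_high {p M u v : ℝ} (hp2 : 2 ≤ p) (hu : |u| ≤ M) (hv : |v| ≤ M) :
    |Jp p u - Jp p v| ≤ (p - 1) * M ^ (p - 2) * |u - v| := by
  have hp : 1 < p := by linarith
  have hM : 0 ≤ M := (abs_nonneg u).trans hu
  have same : ∀ u v : ℝ, 0 ≤ u → 0 ≤ v → u ≤ M → v ≤ M →
      |Jp p u - Jp p v| ≤ (p - 1) * M ^ (p - 2) * |u - v| := by
    intro u v h1 h2 h3 h4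
    rcases le_total v u with h | h
    · rw [abs_of_nonneg (by linarith : 0 ≤ u - v)]; exact Jp_high_ord hp2 h2 h h3
    · rw [abs_sub_comm, abs_sub_comm u v, abs_of_nonneg (by linarith : 0 ≤ v - u)]
      exact Jp_high_ord hp2 h1 h h4
  have opp : ∀ u v : ℝ, 0 ≤ u → 0 ≤ v → u ≤ M → v ≤ M →
      |Jp p u + Jp p v| ≤ (p - 1) * M ^ (p - 2) * |u + v| := by
    intro u v h1 h2 h3 h4
    have a := same u 0 h1 le_rfl h3 hM
    have b := same v 0 h2 le_rfl h4 hM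
    have z : Jp p 0 = 0 := by simp [Jp]
    rw [z, sub_zero, sub_zero, abs_of_nonneg h1] at a
    rw [z, sub_zero, sub_zero, abs_of_nonneg h2] at b
    rw [abs_of_nonneg (by linarith : 0 ≤ u + v)]
    have := abs_add_le (Jp p u) (Jp p v)
    nlinarith
  rcases le_total 0 u with h | h <;> rcases le_total 0 v with h' | h'
  · rw [abs_of_nonneg h] at hu; rw [abs_of_nonneg h'] at hv
    exact same u v h h' hu hv
  · rw [abs_of_nonneg h] at hu; rw [abs_of_nonpos h'] at hv
    have := opp u (-v) h (by linarith) hu hv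
    rwa [Jp_neg, ← sub_eq_add_neg, ← sub_eq_add_neg] at this
  · rw [abs_of_nonpos h] at hu; rw [abs_of_nonneg h'] at hv
    have := opp (-u) v (by linarith) h' hu hv
    rw [Jp_neg] at this
    rw [← abs_neg, ← abs_neg (u - v), neg_sub', neg_sub']
    rwa [sub_neg_eq_add, sub_neg_eq_add]
  · rw [abs_of_nonpos h] at hu; rw [abs_of_nonpos h'] at hv
    have := same (-u) (-v) (by linarith) (by linarith) hu hv
    rw [Jp_neg, Jp_neg] at this
    rw [← abs_neg, ← abs_neg (u - v), neg_sub', neg_sub']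
    exact this

lemma F_bound {p B : ℝ} (hp : 1 < p) (hB : 0 ≤ B) : ∃ C : ℝ, 0 ≤ C ∧
    ∀ u₁ u₂ a r : ℝ, 0 < r → |u₁ + a| ≤ B * r ^ 2 → |u₂ - a| ≤ B * r ^ 2 →
      |u₁| ≤ B * r → |u₂| ≤ B * r → |a| ≤ B * r → a ≠ 0 →
      |Jp p u₁ + Jp p u₂| ≤ C * (r ^ (p - min p 2 + 2) * |a| ^ (min p 2 - 2)) := by
  have tri : ∀ u₁ u₂ a : ℝ, |Jp p u₁ + Jp p u₂| ≤
      |Jp p u₁ - Jp p (-a)| + |Jp p u₂ - Jp p a| := by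
    intro u₁ u₂ a
    have := abs_add_le (Jp p u₁ - Jp p (-a)) (Jp p u₂ - Jp p a)
    rw [Jp_neg] at this ⊢
    have e : Jp p u₁ - -Jp p a + (Jp p u₂ - Jp p a) = Jp p u₁ + Jp p u₂ := by ring
    rwa [e] at this
  rcases le_total p 2 with h | h
  · refine ⟨4 * B, by positivity, ?_⟩
    intro u₁ u₂ a r hr h1 h2 h3 h4 h5 ha
    rw [min_eq_left h]
    have k1 := Jp_low (u := u₁) hp h (neg_ne_zero.2 ha)
    have k2 := Jp_low (u := u₂) hp h ha
    rw [abs_neg, sub_neg_eq_add] at k1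
    have hpos : 0 ≤ |a| ^ (p - 2) := by positivity
    have k3 : 2 * |u₁ + a| * |a| ^ (p - 2) ≤ 2 * (B * r ^ 2) * |a| ^ (p - 2) := by gcongr
    have k4 : 2 * |u₂ - a| * |a| ^ (p - 2) ≤ 2 * (B * r ^ 2) * |a| ^ (p - 2) := by gcongr
    have e : r ^ (p - p + 2) = r ^ 2 := by
      rw [sub_self, zero_add]; exact_mod_cast Real.rpow_natCast r 2
    rw [e]
    have := tri u₁ u₂ a
    nlinarith
  · refine ⟨2 * (p - 1) * B ^ (p - 2) * B, by
      have : 0 ≤ p - 1 := by linarith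
      positivity, ?_⟩
    intro u₁ u₂ a r hr h1 h2 h3 h4 h5 ha
    rw [min_eq_right h, sub_self, Real.rpow_zero, mul_one]
    have k1 := Jp_high (u := u₁) h h3 (by rwa [abs_neg] : |-a| ≤ B * r)
    have k2 := Jp_high (u := u₂) h h4 h5
    rw [sub_neg_eq_add] at k1
    have hp1 : 0 ≤ p - 1 := by linarith
    have hc : 0 ≤ (p - 1) * (B * r) ^ (p - 2) := by positivity
    have k3 := mul_le_mul_of_nonneg_left h1 hc
    have k4 := mul_le_mul_of_nonneg_left h2 hc
    have e : r ^ (p - 2 + 2) = r ^ (p - 2) * r ^ 2 := by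
      rw [Real.rpow_add hr]; congr 1; exact_mod_cast Real.rpow_natCast r 2
    rw [Real.mul_rpow hB hr.le] at *
    rw [e]
    have := tri u₁ u₂ a
    calc _ ≤ _ := this
      _ ≤ _ := add_le_add (k1.trans k3) (k2.trans k4)
      _ = _ := by ring

lemma ae_ne_zero_clm {N : ℕ} (f : Euc N →L[ℝ] ℝ) (hf : f ≠ 0) : ∀ᵐ z : Euc N, f z ≠ 0 := by
  have h := Measure.addHaar_submodule (volume : Measure (Euc N)) (LinearMap.ker (f : Euc N →ₗ[ℝ] ℝ))
    (by
      intro h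
      apply hf
      ext z
      have : z ∈ LinearMap.ker (f : Euc N →ₗ[ℝ] ℝ) := by rw [h]; trivial
      simpa using this)
  rw [ae_iff]
  convert h using 2
  ext z; simp

lemma ae_coord_ne {N : ℕ} : ∀ᵐ z : Euc N, ∀ i, z i ≠ 0 := by
  rw [ae_all_iff]
  intro i
  refine ae_ne_zero_clm (EuclideanSpace.proj i) ?_
  intro h
  have := congrArg (fun f => f (EuclideanSpace.single i 1)) h
  simp at this

lemma integrable_one_dim {b ρ : ℝ} (hb : b < 1) :
    Integrable (indicator (ball (0 : ℝ) ρ) fun t => |t| ^ (-b)) := by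
  rw [integrable_indicator_iff measurableSet_ball]
  refine integrableOn_ball_of_norm_le_rpow (by simp) (C := 1) (α := b) (by simpa using hb) ?_ ?_
  · refine Eventually.of_forall fun x => ?_
    rw [one_mul, Real.norm_eq_abs, Real.norm_eq_abs, abs_of_nonneg (by positivity)]
  · exact Measurable.aestronglyMeasurable (by fun_prop)

lemma integrableOn_model {N : ℕ} (hN : 1 ≤ N) {q κ ρ : ℝ} (hq : 1 < q)
    (hκ : 0 < κ) (hκq : κ ≤ q - 1) :
    IntegrableOn (fun z : Euc N => ‖z‖ ^ (2 - q + κ - N) * |z ⟨0, hN⟩| ^ (q - 2)) (ball 0 ρ) := by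
  set i0 : Fin N := ⟨0, hN⟩ with hi0
  have hN1 : (1 : ℝ) ≤ N := by exact_mod_cast hN
  set θ : ℝ := (N - 2 + q - κ) / (N - 2 + q) with hθ
  have hD : 0 < N - 2 + q := by linarith
  have hθ0 : 0 ≤ θ := div_nonneg (by linarith) hD.le
  have hθ1 : θ < 1 := by rw [hθ, div_lt_one hD]; linarith
  let a : Fin N → ℝ := fun i => if i = i0 then θ * (q - 1) else θ
  let b : Fin N → ℝ := fun i => if i = i0 then θ * (q - 1) + (2 - q) else θ
  have ha0 : ∀ i, 0 ≤ a i := by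
    intro i; simp only [a]; split_ifs
    · exact mul_nonneg hθ0 (by linarith)
    · exact hθ0
  have hb1 : ∀ i, b i < 1 := by
    intro i; simp only [b]; split_ifs
    · nlinarith
    · exact hθ1
  have hsum : ∑ i, (-a i) = 2 - q + κ - N := by
    have h1 : ∀ i, -a i = -θ + (if i = i0 then θ * (2 - q) else 0) := by
      intro i; simp only [a]; split_ifs <;> ring
    simp_rw [h1]
    rw [Finset.sum_add_distrib, Finset.sum_ite_eq']
    simp only [Finset.sum_const, Finset.card_univ, Fintype.card_fin, Finset.mem_univ, if_true,
      nsmul_eq_mul]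
    rw [hθ]; field_simp; ring
  have hprod : Integrable (fun z : Euc N => ∏ i, indicator (ball (0 : ℝ) ρ) (fun t => |t| ^ (-b i)) (z i)) := by
    have h := Integrable.fintype_prod (𝕜 := ℝ) (μ := fun _ : Fin N => (volume : Measure ℝ))
      (f := fun i => indicator (ball (0 : ℝ) ρ) fun t => |t| ^ (-b i))
      (fun i => integrable_one_dim (ρ := ρ) (hb1 i))
    exact (PiLp.volume_preserving_ofLp (Fin N)).integrable_comp_of_integrable h
  refine Integrable.mono' (hprod.integrableOn (s := ball 0 ρ)) ?_ ?_
  · exact Measurable.aestronglyMeasurable (by fun_prop)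
  · rw [ae_restrict_iff' measurableSet_ball]
    filter_upwards [ae_coord_ne (N := N)] with z hz hzρ
    rw [mem_ball_zero_iff] at hzρ
    have hle : ∀ i, |z i| ≤ ‖z‖ := fun i => by
      simpa using PiLp.norm_apply_le z i
    have hpos : ∀ i, 0 < |z i| := fun i => abs_pos.2 (hz i)
    have hzpos : 0 < ‖z‖ := (hpos i0).trans_le (hle i0)
    rw [Real.norm_eq_abs, abs_of_nonneg (by positivity)]
    have e1 : ∀ i, indicator (ball (0 : ℝ) ρ) (fun t => |t| ^ (-b i)) (z i) = |z i| ^ (-b i) := by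
      intro i
      rw [indicator_of_mem]
      rw [mem_ball_zero_iff, Real.norm_eq_abs]
      exact (hle i).trans_lt hzρ
    simp_rw [e1]
    have e2 : ∀ i, |z i| ^ (-b i) = |z i| ^ (-a i) * (if i = i0 then |z i| ^ (q - 2) else 1) := by
      intro i
      by_cases h : i = i0
      · simp only [a, b, h, if_true]
        rw [← Real.rpow_add (hpos i0)]; ring_nf
      · simp [a, b, h]
    simp_rw [e2]
    rw [Finset.prod_mul_distrib, Finset.prod_ite_eq']
    simp only [Finset.mem_univ, if_true]
    gcongr
    rw [← hsum, Real.rpow_sum_of_pos hzpos]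
    exact Finset.prod_le_prod (fun i _ => by positivity)
      (fun i _ => Real.rpow_le_rpow_of_nonpos (hpos i) (hle i) (by have := ha0 i; linarith))

lemma model_rotate {N : ℕ} (hN : 1 ≤ N) {q β r : ℝ} (f : Euc N →L[ℝ] ℝ) 
    (hint : IntegrableOn (fun z : Euc N => ‖z‖ ^ β * |z ⟨0, hN⟩| ^ (q - 2)) (ball 0 r)) :
    IntegrableOn (fun z : Euc N => ‖z‖ ^ β * |f z| ^ (q - 2)) (ball 0 r) ∧
    ∫ z in ball 0 r, ‖z‖ ^ β * |f z| ^ (q - 2) =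
      ‖f‖ ^ (q - 2) * ∫ z : Euc N in ball 0 r, ‖z‖ ^ β * |z ⟨0, hN⟩| ^ (q - 2) := by
  set i0 : Fin N := ⟨0, hN⟩ with hi0
  set v : Euc N := (InnerProductSpace.toDual ℝ (Euc N)).symm f with hv
  have hvn : ‖v‖ = ‖f‖ := by simp [hv]
  have hvf : ∀ z, f z = inner ℝ v z := fun z => by simp [hv]
  set w : Euc N := EuclideanSpace.single i0 ‖v‖ with hw
  have hwn : ‖v‖ = ‖w‖ := by simp [hw]
  set R : Euc N ≃ₗᵢ[ℝ] Euc N := Submodule.reflection (ℝ ∙ (v - w))ᗮ with hR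
  have hRv : R v = w := Submodule.reflection_sub hwn
  have hfR : ∀ z, |f z| = ‖f‖ * |(R z) i0| := by
    intro z
    rw [hvf, ← R.inner_map_map, hRv, hw, EuclideanSpace.inner_single_left, ← hvn]
    simp [abs_mul]
  have hfun : (fun z : Euc N => ‖z‖ ^ β * |f z| ^ (q - 2)) =
      fun z => ‖f‖ ^ (q - 2) * ((fun z : Euc N => ‖z‖ ^ β * |z i0| ^ (q - 2)) ∘ R) z := by
    funext z
    simp only [Function.comp, R.norm_map]
    rw [hfR, Real.mul_rpow (norm_nonneg _) (abs_nonneg _)]; ring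
  have hmp : MeasurePreserving R := R.measurePreserving
  have hemb : MeasurableEmbedding R := R.toHomeomorph.measurableEmbedding
  have hpre : R ⁻¹' (ball 0 r) = ball 0 r := by ext z; simp
  rw [hfun]
  constructor
  · refine Integrable.const_mul ?_ _
    have := (hmp.integrableOn_comp_preimage hemb (s := ball 0 r)).2 hint
    rwa [hpre] at this
  · rw [integral_const_mul]
    congr 1
    have := hmp.setIntegral_preimage_emb hemb (fun z : Euc N => ‖z‖ ^ β * |z i0| ^ (q - 2)) (ball 0 r)
    rw [hpre] at this
    exact this

lemma taylor_bound {N : ℕ} {ρ B : ℝ} {w : Euc N → ℝ} {Dw : Euc N → (Euc N →L[ℝ] ℝ)}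
    {D2w : Euc N → (Euc N →L[ℝ] Euc N →L[ℝ] ℝ)} {x : Euc N}
    (h1 : ∀ y ∈ ball x ρ, HasFDerivAt w (Dw y) y)
    (h2 : ∀ y ∈ ball x ρ, HasFDerivAt Dw (D2w y) y)
    (b1 : ∀ y ∈ ball x ρ, ‖Dw y‖ ≤ B) (b2 : ∀ y ∈ ball x ρ, ‖D2w y‖ ≤ B)
    {z : Euc N} (hz : ‖z‖ < ρ) :
    |w (x + z) - w x| ≤ B * ‖z‖ ∧ |w (x + z) - w x - Dw x z| ≤ B * ‖z‖ ^ 2 := by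
  have hρ : 0 < ρ := (norm_nonneg z).trans_lt hz
  have hx : x ∈ ball x ρ := mem_ball_self hρ
  have hxz : x + z ∈ ball x ρ := by simpa using hz
  have hB : 0 ≤ B := (norm_nonneg _).trans (b1 x hx)
  constructor
  · have := (convex_ball x ρ).norm_image_sub_le_of_norm_hasFDerivWithin_le
      (fun y hy => (h1 y hy).hasFDerivWithinAt) b1 hx hxz
    simpa using this
  · have hs : closedBall x ‖z‖ ⊆ ball x ρ := closedBall_subset_ball hz
    have hl : ∀ y ∈ closedBall x ‖z‖, ‖Dw y - Dw x‖ ≤ B * ‖z‖ := by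
      intro y hy
      have := (convex_ball x ρ).norm_image_sub_le_of_norm_hasFDerivWithin_le
        (fun y hy => (h2 y hy).hasFDerivWithinAt) b2 hx (hs hy)
      refine this.trans ?_
      rw [mem_closedBall, dist_eq_norm] at hy
      gcongr
    have := (convex_closedBall x ‖z‖).norm_image_sub_le_of_norm_hasFDerivWithin_le'
      (fun y hy => (h1 y (hs hy)).hasFDerivWithinAt) hl
      (mem_closedBall_self (norm_nonneg z)) (y := x + z) (by simp)
    simp only [add_sub_cancel_left, Real.norm_eq_abs] at this
    rw [pow_two, ← mul_assoc]; exact this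

/-- centred annulus -/
def annu (N : ℕ) (ρ δ : ℝ) : Set (Euc N) := {z | δ < ‖z‖ ∧ ‖z‖ < ρ}

lemma annu_meas (N : ℕ) (ρ δ : ℝ) : MeasurableSet (annu N ρ δ) :=
  (measurableSet_lt measurable_const measurable_norm).inter
    (measurableSet_lt measurable_norm measurable_const)

lemma annu_sub (N : ℕ) (ρ δ : ℝ) : annu N ρ δ ⊆ ball 0 ρ := fun z hz => by
  simpa using hz.2

lemma pv_plus {N : ℕ} {p ρ δ : ℝ} (hδ : 0 ≤ δ) {K : Euc N → ℝ}
    (hKsymm : ∀ z : Euc N, z ≠ 0 → K (-z) = K z) (w : Euc N → ℝ) (x : Euc N) :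
    pvIntegral N p ρ K w x δ = ∫ z in annu N ρ δ, Jp p (w x - w (x + z)) * K z := by
  unfold pvIntegral
  have hmp := measurePreserving_add_left (volume : Measure (Euc N)) x
  have := hmp.setIntegral_preimage_emb (measurableEmbedding_addLeft x)
    (fun y => Jp p (w x - w y) * K (x - y)) {y : Euc N | δ < dist y x ∧ dist y x < ρ}
  rw [← this]
  have hpre : (fun z => x + z) ⁻¹' {y : Euc N | δ < dist y x ∧ dist y x < ρ} = annu N ρ δ := by
    ext z; simp [annu]
  rw [hpre]
  refine setIntegral_congr_fun (annu_meas N ρ δ) ?_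
  intro z hz
  have hz0 : z ≠ 0 := norm_pos_iff.1 (hδ.trans_lt hz.1)
  simp only
  rw [← hKsymm z hz0]; congr 2; abel

lemma annu_neg {N : ℕ} {p ρ δ : ℝ} (hδ : 0 ≤ δ) {K : Euc N → ℝ}
    (hKsymm : ∀ z : Euc N, z ≠ 0 → K (-z) = K z) (w : Euc N → ℝ) (x : Euc N) :
    ∫ z in annu N ρ δ, Jp p (w x - w (x + z)) * K z =
      ∫ z in annu N ρ δ, Jp p (w x - w (x - z)) * K z := by
  have hmp := Measure.measurePreserving_neg (volume : Measure (Euc N))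
  have := hmp.setIntegral_preimage_emb (MeasurableEquiv.neg (Euc N)).measurableEmbedding
    (fun z => Jp p (w x - w (x + z)) * K z) (annu N ρ δ)
  rw [← this]
  have hpre : (Neg.neg) ⁻¹' (annu N ρ δ) = annu N ρ δ := by
    ext z; simp [annu]
  rw [hpre]
  refine setIntegral_congr_fun (annu_meas N ρ δ) ?_
  intro z hz
  have hz0 : z ≠ 0 := norm_pos_iff.1 (hδ.trans_lt hz.1)
  simp only
  rw [← hKsymm z hz0, sub_eq_add_neg x z]

lemma aesm_plus {N : ℕ} {p ρ : ℝ} (hp : 1 < p) {K : Euc N → ℝ} (hKm : Measurable K)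
    {w : Euc N → ℝ} {x : Euc N} (hw : ContinuousOn w (ball x ρ)) :
    AEStronglyMeasurable (fun z => Jp p (w x - w (x + z)) * K z)
      (volume.restrict (ball (0 : Euc N) ρ)) := by
  refine AEStronglyMeasurable.mul ?_ hKm.aestronglyMeasurable
  refine ContinuousOn.aestronglyMeasurable ?_ measurableSet_ball
  refine (Jp_continuous hp).comp_continuousOn (continuousOn_const.sub ?_)
  exact hw.comp (by fun_prop) (fun z hz => by simpa using hz)

lemma aesm_minus {N : ℕ} {p ρ : ℝ} (hp : 1 < p) {K : Euc N → ℝ} (hKm : Measurable K)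
    {w : Euc N → ℝ} {x : Euc N} (hw : ContinuousOn w (ball x ρ)) :
    AEStronglyMeasurable (fun z => Jp p (w x - w (x - z)) * K z)
      (volume.restrict (ball (0 : Euc N) ρ)) := by
  refine AEStronglyMeasurable.mul ?_ hKm.aestronglyMeasurable
  refine ContinuousOn.aestronglyMeasurable ?_ measurableSet_ball
  refine (Jp_continuous hp).comp_continuousOn (continuousOn_const.sub ?_)
  exact hw.comp (by fun_prop) (fun z hz => by simpa using hz)

lemma annu_bound {N : ℕ} {p s Lam δ B : ℝ} (hp : 1 < p) (hs : 0 < s) (hLam : 0 < Lam) (hδ : 0 < δ)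
    {K : Euc N → ℝ} (hKpos : ∀ z : Euc N, z ≠ 0 → 0 < K z)
    (hKub : ∀ z : Euc N, z ≠ 0 → K z ≤ Lam * ‖z‖ ^ (-((N : ℝ) + s * p)))
    {a b : ℝ} (ha : |a| ≤ B) (hb : |b| ≤ B) {z : Euc N} (hz : δ < ‖z‖) :
    ‖Jp p (a - b) * K z‖ ≤ (2 * B) ^ (p - 1) * (Lam * δ ^ (-((N : ℝ) + s * p))) := by
  have hz0 : z ≠ 0 := norm_pos_iff.1 (hδ.trans hz)
  rw [norm_mul, Real.norm_eq_abs, Real.norm_eq_abs, abs_Jp hp, abs_of_pos (hKpos z hz0)]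
  have h1 : |a - b| ≤ 2 * B := by
    have := abs_sub a b
    linarith
  have hB : 0 ≤ B := (abs_nonneg a).trans ha
  have h2 : |a - b| ^ (p - 1) ≤ (2 * B) ^ (p - 1) :=
    Real.rpow_le_rpow (abs_nonneg _) h1 (by linarith)
  have h3 : K z ≤ Lam * δ ^ (-((N : ℝ) + s * p)) := by
    refine (hKub z hz0).trans ?_
    have : ‖z‖ ^ (-((N : ℝ) + s * p)) ≤ δ ^ (-((N : ℝ) + s * p)) :=
      Real.rpow_le_rpow_of_nonpos hδ hz.le (by
        have : 0 ≤ s * p := by positivity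
        have : (0 : ℝ) ≤ N := by positivity
        linarith)
    gcongr
  have := (hKpos z hz0).le
  gcongr

lemma integrableOn_const_annu (N : ℕ) (ρ δ c : ℝ) :
    Integrable (fun _ : Euc N => c) (volume.restrict (annu N ρ δ)) := by
  have : volume (annu N ρ δ) < ⊤ := (measure_mono (annu_sub N ρ δ)).trans_lt measure_ball_lt_top
  have : IsFiniteMeasure (volume.restrict (annu N ρ δ)) := ⟨by simpa using this⟩
  exact integrable_const c

lemma pv_sym {N : ℕ} {p s Lam ρ δ B : ℝ} (hp : 1 < p) (hs : 0 < s) (hLam : 0 < Lam) (hδ : 0 < δ)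
    {K : Euc N → ℝ} (hKm : Measurable K) (hKpos : ∀ z : Euc N, z ≠ 0 → 0 < K z)
    (hKsymm : ∀ z : Euc N, z ≠ 0 → K (-z) = K z)
    (hKub : ∀ z : Euc N, z ≠ 0 → K z ≤ Lam * ‖z‖ ^ (-((N : ℝ) + s * p)))
    {w : Euc N → ℝ} {x : Euc N} (hρ : 0 < ρ) (hw : ContinuousOn w (ball x ρ))
    (hwB : ∀ y ∈ ball x ρ, |w y| ≤ B) :
    pvIntegral N p ρ K w x δ = 1 / 2 * ∫ z in annu N ρ δ,
      (Jp p (w x - w (x + z)) + Jp p (w x - w (x - z))) * K z := by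
  have i1 : Integrable (fun z => Jp p (w x - w (x + z)) * K z) (volume.restrict (annu N ρ δ)) := by
    refine Integrable.mono' (integrableOn_const_annu N ρ δ
      ((2 * B) ^ (p - 1) * (Lam * δ ^ (-((N : ℝ) + s * p)))))
      ((aesm_plus hp hKm hw).mono_measure (Measure.restrict_mono (annu_sub N ρ δ) le_rfl)) ?_
    rw [ae_restrict_iff' (annu_meas N ρ δ)]
    refine Eventually.of_forall fun z hz => annu_bound hp hs hLam hδ hKpos hKub
      (hwB x (mem_ball_self hρ)) (hwB _ (by simpa using hz.2)) hz.1
  have i2 : Integrable (fun z => Jp p (w x - w (x - z)) * K z) (volume.restrict (annu N ρ δ)) := by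
    refine Integrable.mono' (integrableOn_const_annu N ρ δ
      ((2 * B) ^ (p - 1) * (Lam * δ ^ (-((N : ℝ) + s * p)))))
      ((aesm_minus hp hKm hw).mono_measure (Measure.restrict_mono (annu_sub N ρ δ) le_rfl)) ?_
    rw [ae_restrict_iff' (annu_meas N ρ δ)]
    refine Eventually.of_forall fun z hz => annu_bound hp hs hLam hδ hKpos hKub
      (hwB x (mem_ball_self hρ)) (hwB _ (by simpa using hz.2)) hz.1
  simp_rw [add_mul]
  rw [integral_add i1 i2, ← annu_neg hδ.le hKsymm, ← pv_plus hδ.le hKsymm]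
  ring

lemma K_bound {N : ℕ} {p s Lam ρ κ : ℝ} (hLam : 0 < Lam) (hκ : κ ≤ p - s * p)
    {K : Euc N → ℝ} (hKub : ∀ z : Euc N, z ≠ 0 → K z ≤ Lam * ‖z‖ ^ (-((N : ℝ) + s * p)))
    {z : Euc N} (hz : z ≠ 0) (hzρ : ‖z‖ < ρ) :
    K z ≤ Lam * ρ ^ (p - κ - s * p) * ‖z‖ ^ (-((N : ℝ) + p - κ)) := by
  have hn : 0 < ‖z‖ := norm_pos_iff.2 hz
  refine (hKub z hz).trans ?_
  have e : ‖z‖ ^ (-((N : ℝ) + s * p)) = ‖z‖ ^ (p - κ - s * p) * ‖z‖ ^ (-((N : ℝ) + p - κ)) := by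
    rw [← Real.rpow_add hn]; ring_nf
  rw [e, mul_assoc]
  have : ‖z‖ ^ (p - κ - s * p) ≤ ρ ^ (p - κ - s * p) :=
    Real.rpow_le_rpow hn.le hzρ.le (by linarith)
  gcongr

/-- existence of the principal value of the truncated operator and
continuity of `(x,t) ↦ ∂ₜφ(x,t) + L_K^{B_ρ} φ(x,t)` on `𝒦 × I`. -/
theorem truncated_operator_continuity
    (N : ℕ) (hN : 1 ≤ N) (p s Lam : ℝ)
    (hp : 1 < p) (hs : s ∈ Ioo (0 : ℝ) 1) (hLam : 0 < Lam)
    (K : Euc N → ℝ)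
    (hKm : Measurable K) (hKpos : ∀ z : Euc N, z ≠ 0 → 0 < K z)
    (hKsymm : ∀ z : Euc N, z ≠ 0 → K (-z) = K z)
    (hKub : ∀ z : Euc N, z ≠ 0 → K z ≤ Lam * ‖z‖ ^ (-((N : ℝ) + s * p)))
    (Ω U 𝒦 : Set (Euc N)) (I : Set ℝ)
    (hΩ : IsOpen Ω) (h𝒦 : IsCompact 𝒦) (h𝒦Ω : 𝒦 ⊆ Ω)
    (hI : Bornology.IsBounded I) (hIc : I.OrdConnected)
    (hU : IsOpen U) (h𝒦U : 𝒦 ⊆ U) (hUc : IsCompact (closure U)) (hUΩ : closure U ⊆ Ω)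
    (ρ : ℝ) (hρ : 0 < ρ) (hρU : ∀ x ∈ 𝒦, ball x ρ ⊆ U)
    (φ : Euc N → ℝ → ℝ) (Dφ : Euc N → ℝ → (Euc N →L[ℝ] ℝ))
    (D2φ : Euc N → ℝ → (Euc N →L[ℝ] Euc N →L[ℝ] ℝ)) (φt : Euc N → ℝ → ℝ)
    (hreg : C2xC1t N U I φ Dφ D2φ φt)
    (hbd : ∃ B : ℝ, ∀ x ∈ U, ∀ t ∈ I,
      |φ x t| ≤ B ∧ ‖Dφ x t‖ ≤ B ∧ ‖D2φ x t‖ ≤ B ∧ |φt x t| ≤ B)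
    (hgrad : ∀ x ∈ 𝒦, ∀ t ∈ I, Dφ x t ≠ 0) :
    ∃ L : Euc N → ℝ → ℝ,
      (∀ x ∈ 𝒦, ∀ t ∈ I, HasPV N p ρ K (fun y => φ y t) x (L x t)) ∧
      ContinuousOn (fun q : Euc N × ℝ => φt q.1 q.2 + L q.1 q.2) (𝒦 ×ˢ I) := by
  classical
  obtain ⟨B₀, hB₀⟩ := hbd
  obtain ⟨c0, c1, c2, c3, c4, c5, c6⟩ := hreg
  obtain ⟨B, hB0, hB⟩ : ∃ B : ℝ, 0 ≤ B ∧ ∀ x ∈ U, ∀ t ∈ I,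
      |φ x t| ≤ B ∧ ‖Dφ x t‖ ≤ B ∧ ‖D2φ x t‖ ≤ B := by
    refine ⟨max B₀ 0, le_max_right _ _, fun x hx t ht => ?_⟩
    obtain ⟨h1, h2, h3, _⟩ := hB₀ x hx t ht
    exact ⟨h1.trans (le_max_left _ _), h2.trans (le_max_left _ _), h3.trans (le_max_left _ _)⟩
  have hs0 := hs.1
  have hsp : s * p < p := by nlinarith [hs.2]
  obtain ⟨C, hC0, hC⟩ := F_bound hp hB0
  set q : ℝ := min p 2 with hq
  have hq1 : 1 < q := lt_min hp (by norm_num)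
  have hq2 : q ≤ 2 := min_le_right _ _
  set κ : ℝ := min (p - s * p) (q - 1) with hκ
  have hκ0 : 0 < κ := lt_min (by linarith) (by linarith)
  have hκ1 : κ ≤ p - s * p := min_le_left _ _
  have hκ2 : κ ≤ q - 1 := min_le_right _ _
  set β : ℝ := 2 - q + κ - N with hβ
  have hmodel := integrableOn_model hN (ρ := ρ) hq1 hκ0 hκ2
  rw [← hβ] at hmodel
  set C' : ℝ := C * (Lam * ρ ^ (p - κ - s * p)) with hC'
  have hC'0 : 0 ≤ C' := by positivity
  -- symmetrized integrand
  let G : Euc N → ℝ → Euc N → ℝ := fun x t z =>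
    (Jp p (φ x t - φ (x + z) t) + Jp p (φ x t - φ (x - z) t)) * K z
  have hcont : ∀ x ∈ 𝒦, ∀ t ∈ I, ContinuousOn (fun y => φ y t) (ball x ρ) := by
    intro x hx t ht y hy
    exact (c1 y (hρU x hx hy) t ht).continuousAt.continuousWithinAt
  have hGb : ∀ x ∈ 𝒦, ∀ t ∈ I, ∀ᵐ z ∂(volume.restrict (ball (0 : Euc N) ρ)),
      ‖G x t z‖ ≤ C' * (‖z‖ ^ β * |Dφ x t z| ^ (q - 2)) := by
    intro x hx t ht
    rw [ae_restrict_iff' measurableSet_ball]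
    filter_upwards [ae_ne_zero_clm (Dφ x t) (hgrad x hx t ht)] with z hz hzρ
    rw [mem_ball_zero_iff] at hzρ
    have hz0 : z ≠ 0 := by rintro rfl; simp at hz
    have hn : 0 < ‖z‖ := norm_pos_iff.2 hz0
    have hxU : ∀ y ∈ ball x ρ, y ∈ U := fun y hy => hρU x hx hy
    have tay : ∀ z : Euc N, ‖z‖ < ρ → _ := fun z hz =>
      taylor_bound (w := fun y => φ y t) (Dw := fun y => Dφ y t) (D2w := fun y => D2φ y t)
      (fun y hy => c1 y (hxU y hy) t ht) (fun y hy => c3 y (hxU y hy) t ht)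
      (fun y hy => (hB y (hxU y hy) t ht).2.1) (fun y hy => (hB y (hxU y hy) t ht).2.2) hz
    obtain ⟨t1, t2⟩ := tay z hzρ
    obtain ⟨t3, t4⟩ := tay (-z) (by rwa [norm_neg])
    simp only [norm_neg, map_neg, ← sub_eq_add_neg, sub_neg_eq_add] at t1 t2 t3 t4
    have hF := hC (φ x t - φ (x + z) t) (φ x t - φ (x - z) t) (Dφ x t z) ‖z‖ hn
      (by rw [← abs_neg]; convert t2 using 2; ring)
      (by rw [← abs_neg]; convert t4 using 2; ring)
      (by rwa [abs_sub_comm]) (by rwa [abs_sub_comm])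
      (by
        have h1 := (Dφ x t).le_opNorm z
        have h2 := (hB x (h𝒦U hx) t ht).2.1
        rw [Real.norm_eq_abs] at h1
        exact h1.trans (by gcongr)) hz
    have hK := K_bound hLam hκ1 hKub hz0 hzρ
    simp only [G]
    rw [norm_mul, Real.norm_eq_abs, Real.norm_eq_abs, abs_of_pos (hKpos z hz0)]
    have e : ‖z‖ ^ β = ‖z‖ ^ (p - q + 2) * ‖z‖ ^ (-((N : ℝ) + p - κ)) := by
      rw [← Real.rpow_add hn, hβ]; ring_nf
    have hk0 := (hKpos z hz0).le
    calc _ ≤ (C * (‖z‖ ^ (p - q + 2) * |Dφ x t z| ^ (q - 2))) *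
          (Lam * ρ ^ (p - κ - s * p) * ‖z‖ ^ (-((N : ℝ) + p - κ))) := by gcongr
      _ = _ := by rw [e, hC']; ring
  have hdom : ∀ x ∈ 𝒦, ∀ t ∈ I, IntegrableOn
      (fun z => C' * (‖z‖ ^ β * |Dφ x t z| ^ (q - 2))) (ball 0 ρ) := by
    intro x hx t ht
    exact (model_rotate hN (Dφ x t) hmodel).1.const_mul _
  have hGint : ∀ x ∈ 𝒦, ∀ t ∈ I, IntegrableOn (G x t) (ball 0 ρ) := by
    intro x hx t ht
    refine Integrable.mono' (hdom x hx t ht) ?_ (hGb x hx t ht)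
    have := (aesm_plus hp hKm (hcont x hx t ht)).add (aesm_minus hp hKm (hcont x hx t ht))
    refine this.congr (Eventually.of_forall fun z => ?_)
    simp only [G, Pi.add_apply]; ring
  let L : Euc N → ℝ → ℝ := fun x t => 1 / 2 * ∫ z in ball 0 ρ, G x t z
  let m : ℝ → ℝ := fun r => ∫ z : Euc N in ball 0 r, ‖z‖ ^ β * |z ⟨0, hN⟩| ^ (q - 2)
  have hm0 : ∀ r, 0 ≤ m r := fun r => integral_nonneg fun z => by positivity
  have hest : ∀ δ, 0 < δ → 2 * δ ≤ ρ → ∀ x ∈ 𝒦, ∀ t ∈ I,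
      |L x t - pvIntegral N p ρ K (fun y => φ y t) x δ| ≤ C' * ‖Dφ x t‖ ^ (q - 2) * m (2 * δ) := by
    intro δ hδ hδρ x hx t ht
    rw [pv_sym hp hs0 hLam hδ hKm hKpos hKsymm hKub hρ (hcont x hx t ht)
      (fun y hy => (hB y (hρU x hx hy) t ht).1)]
    change |1 / 2 * (∫ z in ball 0 ρ, G x t z) - 1 / 2 * ∫ z in annu N ρ δ, G x t z| ≤ _
    rw [← mul_sub, ← setIntegral_sdiff (annu_meas N ρ δ) (hGint x hx t ht) (annu_sub N ρ δ),
      abs_mul]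
    have hsub : ball (0 : Euc N) ρ \ annu N ρ δ ⊆ ball 0 (2 * δ) := by
      rintro z ⟨h1, h2⟩
      rw [mem_ball_zero_iff] at *
      by_contra h
      exact h2 ⟨by linarith, h1⟩
    have hsub2 : ball (0 : Euc N) (2 * δ) ⊆ ball 0 ρ := ball_subset_ball hδρ
    have hd := (hdom x hx t ht)
    have k1 : |∫ z in ball (0 : Euc N) ρ \ annu N ρ δ, G x t z| ≤
        ∫ z in ball (0 : Euc N) ρ \ annu N ρ δ, C' * (‖z‖ ^ β * |Dφ x t z| ^ (q - 2)) := by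
      rw [← Real.norm_eq_abs]
      exact norm_integral_le_of_norm_le (hd.mono_set sdiff_subset)
        (ae_restrict_of_ae_restrict_of_subset sdiff_subset (hGb x hx t ht))
    have k2 : ∫ z in ball (0 : Euc N) ρ \ annu N ρ δ, C' * (‖z‖ ^ β * |Dφ x t z| ^ (q - 2)) ≤
        ∫ z in ball (0 : Euc N) (2 * δ), C' * (‖z‖ ^ β * |Dφ x t z| ^ (q - 2)) :=
      setIntegral_mono_set (hd.mono_set hsub2)
        (Eventually.of_forall fun z => by simp only [Pi.zero_apply]; positivity)
        (Eventually.of_forall hsub)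
    rw [abs_of_pos (by norm_num : (0 : ℝ) < 1 / 2)]
    have := abs_nonneg (∫ z in ball (0 : Euc N) ρ \ annu N ρ δ, G x t z)
    have k3 := k1.trans k2
    rw [integral_const_mul, (model_rotate hN (Dφ x t) (hmodel.mono_set hsub2)).2, ← mul_assoc] at k3
    simp only [m]
    linarith
  have hmlim : Tendsto (fun δ => m (2 * δ)) (𝓝[>] 0) (𝓝 0) := by
    have h1 : ∀ᶠ δ in 𝓝[>] (0 : ℝ), 2 * δ ≤ ρ := by
      filter_upwards [Ioo_mem_nhdsGT (by positivity : (0 : ℝ) < ρ / 2)] with δ hδ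
      linarith [hδ.2]
    have h2 := Integrable.tendsto_setIntegral_nhds_zero (l := 𝓝[>] (0 : ℝ)) hmodel
      (s := fun δ => ball (0 : Euc N) (2 * δ)) (by
        have hv : ∀ δ : ℝ, volume.restrict (ball (0 : Euc N) ρ) (ball (0 : Euc N) (2 * δ)) ≤
            ENNReal.ofReal ((2 * δ) ^ N) * volume (ball (0 : Euc N) 1) := by
          intro δ
          refine (Measure.restrict_apply_le _ _).trans ?_
          rcases le_or_gt (2 * δ) 0 with h | h
          · rw [ball_eq_empty.2 h]; simp
          · rw [Measure.addHaar_ball_of_pos _ _ h]; simp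
        refine tendsto_of_tendsto_of_tendsto_of_le_of_le tendsto_const_nhds ?_
          (fun δ => zero_le) hv
        have h3 : Tendsto (fun δ : ℝ => (2 * δ) ^ N) (𝓝[>] 0) (𝓝 0) := by
          have : Continuous fun δ : ℝ => (2 * δ) ^ N := by fun_prop
          have := this.tendsto 0
          simp only [mul_zero, zero_pow (by omega : N ≠ 0)] at this
          exact this.mono_left nhdsWithin_le_nhds
        have h4 := ENNReal.Tendsto.mul_const (b := volume (ball (0 : Euc N) 1))
          (ENNReal.tendsto_ofReal h3) (Or.inr measure_ball_lt_top.ne)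
        simpa using h4)
    refine h2.congr' ?_
    filter_upwards [h1] with δ hδ
    simp only [m]
    rw [Measure.restrict_restrict measurableSet_ball,
      inter_eq_left.2 (ball_subset_ball hδ)]
  have hloc : TendstoLocallyUniformlyOn
      (fun (δ : ℝ) (r : Euc N × ℝ) => pvIntegral N p ρ K (fun y => φ y r.2) r.1 δ)
      (fun r => L r.1 r.2) (𝓝[>] 0) (𝒦 ×ˢ I) := by
    rw [Metric.tendstoLocallyUniformlyOn_iff]
    intro ε hε r₀ hr₀
    have hDc : ContinuousOn (fun r : Euc N × ℝ => ‖Dφ r.1 r.2‖ ^ (q - 2)) (𝒦 ×ˢ I) := by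
      refine ContinuousOn.rpow_const ((c2.mono (prod_mono h𝒦U le_rfl)).norm) ?_
      intro r hr
      exact Or.inl (norm_ne_zero_iff.2 (hgrad r.1 hr.1 r.2 hr.2))
    set M := ‖Dφ r₀.1 r₀.2‖ ^ (q - 2) + 1 with hM
    have hnear : ∀ᶠ r in 𝓝[𝒦 ×ˢ I] r₀, ‖Dφ r.1 r.2‖ ^ (q - 2) < M :=
      (hDc r₀ hr₀).eventually (gt_mem_nhds (by linarith))
    refine ⟨{r | ‖Dφ r.1 r.2‖ ^ (q - 2) < M ∧ r ∈ 𝒦 ×ˢ I}, hnear.and self_mem_nhdsWithin, ?_⟩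
    have hlim : Tendsto (fun δ => C' * M * m (2 * δ)) (𝓝[>] 0) (𝓝 0) := by
      simpa using hmlim.const_mul (C' * M)
    filter_upwards [hlim.eventually (gt_mem_nhds hε),
      Ioo_mem_nhdsGT (by positivity : (0 : ℝ) < ρ / 2)] with δ h1 h2 r hr
    rw [Real.dist_eq]
    refine (hest δ h2.1 (by linarith [h2.2]) r.1 hr.2.1 r.2 hr.2.2).trans_lt (lt_of_le_of_lt ?_ h1)
    have := hm0 (2 * δ)
    have := hr.1.le
    gcongr
  have hpvc : ∀ δ : ℝ, 0 < δ → ContinuousOn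
      (fun r : Euc N × ℝ => pvIntegral N p ρ K (fun y => φ y r.2) r.1 δ) (𝒦 ×ˢ I) := by
    intro δ hδ
    have e : (fun r : Euc N × ℝ => pvIntegral N p ρ K (fun y => φ y r.2) r.1 δ) =
        fun r => ∫ z in annu N ρ δ, Jp p (φ r.1 r.2 - φ (r.1 + z) r.2) * K z := by
      funext r; exact pv_plus hδ.le hKsymm _ _
    rw [e]
    refine continuousOn_of_dominated (bound := fun _ =>
      (2 * B) ^ (p - 1) * (Lam * δ ^ (-((N : ℝ) + s * p)))) ?_ ?_
      (integrableOn_const_annu N ρ δ _) ?_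
    · intro r hr
      exact (aesm_plus hp hKm (hcont r.1 hr.1 r.2 hr.2)).mono_measure
        (Measure.restrict_mono (annu_sub N ρ δ) le_rfl)
    · intro r hr
      rw [ae_restrict_iff' (annu_meas N ρ δ)]
      refine Eventually.of_forall fun z hz => annu_bound hp hs0 hLam hδ hKpos hKub
        (hB _ (h𝒦U hr.1) _ hr.2).1 (hB _ (hρU _ hr.1 (by simpa using hz.2)) _ hr.2).1 hz.1
    · rw [ae_restrict_iff' (annu_meas N ρ δ)]
      refine Eventually.of_forall fun z hz => ?_
      refine ContinuousOn.mul ?_ continuousOn_const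
      refine (Jp_continuous hp).comp_continuousOn ((c0.mono (prod_mono h𝒦U le_rfl)).sub ?_)
      exact c0.comp (f := fun r : Euc N × ℝ => (r.1 + z, r.2)) (by fun_prop)
        (fun r hr => ⟨hρU _ hr.1 (by simpa using hz.2), hr.2⟩)
  refine ⟨L, fun x hx t ht => hloc.tendsto_at (a := (x, t)) ⟨hx, ht⟩, ?_⟩
  refine (c6.mono (prod_mono h𝒦U le_rfl)).add ?_
  refine hloc.continuousOn (Eventually.frequently ?_)
  filter_upwards [self_mem_nhdsWithin] with δ hδ
  exact hpvc δ hδ
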